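/- arXiv:1305.1366 — 2 statements merged into one kernel-verified Lean document; each statement's English description precedes it below -/
import Mathlib

section
/- Let n ≥ 11 with n ≡ 4 (mod 5), and let f ∈ ℤ/nℤ. If S is a Type II set for P_f(n,2), then |S| ≥ ⌈3n/5⌉. -/
namespace PetersenDom

/-- Vertex set of the generalized Petersen graph: `Sum.inl i` is the outer
vertex `u_i`, `Sum.inr i` is the inner vertex `v_i`, indices in `ZMod n`. -/
abbrev PVert (n : ℕ) := ZMod n ⊕ ZMod n

/-- The outer vertex `u_i`. -/
def uV {n : ℕ} (i : ZMod n) : PVert n := Sum.inl i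

/-- The inner vertex `v_i`. -/
def vV {n : ℕ} (i : ZMod n) : PVert n := Sum.inr i

/-- The generalized Petersen graph `P(n,2)`, with edges
`u_i u_{i+1}`, `u_i v_i`, `v_i v_{i+2}` (indices mod `n`). -/
def P2 (n : ℕ) : SimpleGraph (PVert n) :=
  SimpleGraph.fromRel (fun a b =>
    (∃ i : ZMod n, a = uV i ∧ b = uV (i + 1)) ∨
    (∃ i : ZMod n, a = uV i ∧ b = vV i) ∨
    (∃ i : ZMod n, a = vV i ∧ b = vV (i + 2)))

/-- `S` is a dominating set of `G`: every vertex is in `S` or adjacent to a vertex of `S`. -/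
def IsDomSet {V : Type*} (G : SimpleGraph V) (S : Set V) : Prop :=
  ∀ v : V, v ∈ S ∨ ∃ u ∈ S, G.Adj u v

/-- The domination number of `G`. -/
noncomputable def domNum {V : Type*} (G : SimpleGraph V) : ℕ :=
  sInf {k | ∃ S : Set V, IsDomSet G S ∧ S.ncard = k}

/-- `S` is a dominating set of `P_f(n,2) = P(n,2) - u_f`: it avoids `u_f`
and dominates every vertex other than `u_f`. -/
def IsDomSetF (n : ℕ) (f : ZMod n) (S : Set (PVert n)) : Prop :=
  uV f ∉ S ∧ ∀ v : PVert n, v ≠ uV f → v ∈ S ∨ ∃ u ∈ S, (P2 n).Adj u v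

/-- The domination number of `P_f(n,2)`. -/
noncomputable def domNumF (n : ℕ) (f : ZMod n) : ℕ :=
  sInf {k | ∃ S : Set (PVert n), IsDomSetF n f S ∧ S.ncard = k}

/-- `S` is a minimum dominating set of `P_f(n,2)`. -/
def MinDomF (n : ℕ) (f : ZMod n) (S : Set (PVert n)) : Prop :=
  IsDomSetF n f S ∧ S.ncard = domNumF n f

/-- The neighborhood `N(u_f) = {u_{f-1}, u_{f+1}, v_f}` of `u_f` in `P(n,2)`. -/
def Nbr (n : ℕ) (f : ZMod n) : Set (PVert n) := {uV (f - 1), uV (f + 1), vV f}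

/-- The block `B_i`: the 5 consecutive pairs of vertices centered at `u_i, v_i`. -/
def Blk (n : ℕ) (i : ZMod n) : Set (PVert n) :=
  {uV (i-2), uV (i-1), uV i, uV (i+1), uV (i+2),
   vV (i-2), vV (i-1), vV i, vV (i+1), vV (i+2)}

/-- `γ_i(S) = |B_i ∩ S|`. -/
noncomputable def gam (n : ℕ) (i : ZMod n) (S : Set (PVert n)) : ℕ :=
  (Blk n i ∩ S).ncard

/-- `L_i = {v_{i-1}, u_{i-2}, v_{i-2}}`. -/
def Lset (n : ℕ) (i : ZMod n) : Set (PVert n) := {vV (i-1), uV (i-2), vV (i-2)}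

/-- `R_i = {v_{i+1}, u_{i+2}, v_{i+2}}`. -/
def Rset (n : ℕ) (i : ZMod n) : Set (PVert n) := {vV (i+1), uV (i+2), vV (i+2)}

/-- `M_i = {u_{i-1}, v_i, u_{i+1}}`. -/
def Mset (n : ℕ) (i : ZMod n) : Set (PVert n) := {uV (i-1), vV i, uV (i+1)}

/-- `F = {f-2, f-1, f, f+1, f+2}`, the indices of the block `B_f`. -/
def Fset (n : ℕ) (f : ZMod n) : Set (ZMod n) := {f-2, f-1, f, f+1, f+2}

/-- A Type I set: a minimum dominating set `S` of `P_f(n,2)` with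
`γ_i(S) ≥ 2` for all `i`. -/
def TypeI (n : ℕ) (f : ZMod n) (S : Set (PVert n)) : Prop :=
  MinDomF n f S ∧ ∀ i : ZMod n, 2 ≤ gam n i S

/-- The couple number of `S`: the number of indices `i ∉ F` with `γ_i(S) = 2`. -/
noncomputable def coupleNum (n : ℕ) (f : ZMod n) (S : Set (PVert n)) : ℕ :=
  {i : ZMod n | gam n i S = 2 ∧ i ∉ Fset n f}.ncard

/-- A Type II set: a Type I set with `N(u_f) ∩ S = ∅`, `γ_f(S) = 3`, and
`B_f ∩ S = {u_{f-2}, v_{f+1}, v_{f+2}}`. -/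
def TypeII (n : ℕ) (f : ZMod n) (S : Set (PVert n)) : Prop :=
  TypeI n f S ∧ Nbr n f ∩ S = ∅ ∧ gam n f S = 3 ∧
    Blk n f ∩ S = {uV (f-2), vV (f+1), vV (f+2)}

/-- A Type III set: a Type I set with `N(u_f) ∩ S = ∅`, `γ_f(S) = 4`, and
`B_f ∩ S` one of four specified patterns. -/
def TypeIII (n : ℕ) (f : ZMod n) (S : Set (PVert n)) : Prop :=
  TypeI n f S ∧ Nbr n f ∩ S = ∅ ∧ gam n f S = 4 ∧
    (Blk n f ∩ S = {vV (f-1), vV (f+1), uV (f+2), vV (f+2)} ∨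
     Blk n f ∩ S = {uV (f-2), vV (f-2), uV (f+2), vV (f+2)} ∨
     Blk n f ∩ S = {vV (f-2), vV (f-1), vV (f+1), vV (f+2)} ∨
     Blk n f ∩ S = {uV (f-2), vV (f-2), vV (f+1), uV (f+2)})

/-- `⌈3n/5⌉`. -/
noncomputable def ceil35 (n : ℕ) : ℕ := ⌈(3 * (n : ℚ)) / 5⌉₊

/-- The bondage number of `G`: the least number of edges whose deletion
increases the domination number. -/
noncomputable def bondage {V : Type*} (G : SimpleGraph V) : ℕ :=
  sInf {k | ∃ E : Set (Sym2 V), E ⊆ G.edgeSet ∧ E.ncard = k ∧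
    domNum G < domNum (G.deleteEdges E)}

/-- The domination alteration number of `G`: the least number of vertices
whose removal changes the domination number. -/
noncomputable def alterNum {V : Type*} (G : SimpleGraph V) : ℕ :=
  sInf {k | ∃ A : Set V, A.ncard = k ∧ domNum (G.induce Aᶜ) ≠ domNum G}

end PetersenDom
namespace PetersenDom


/-- The status of a vertex relative to the columns seen so far: `2` if it is selected,
`1` if it is not selected but has a selected neighbor, `0` if it is not yet dominated. -/
def status (mem nbr : Bool) : Fin 3 := if mem then 2 else if nbr then 1 else 0

/-- `statusBound s p q r` is a lower bound, up to three times the number of complete rounds of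
five columns, for the number of selected vertices in the columns seen so far, when `r` is the index
of the last column modulo `5`, `s` is the status of its outer vertex, and `p`, `q` are the statuses
of the last two inner vertices. -/
def statusBound : Fin 3 → Fin 3 → Fin 3 → ZMod 5 → ℕ :=
  ![
    ![![![0, 0, 1, 2, 2], ![0, 1, 1, 2, 2], ![0, 1, 2, 3, 3]],
      ![![0, 1, 2, 2, 3], ![1, 2, 2, 2, 3], ![1, 2, 2, 3, 4]],
      ![![0, 1, 2, 2, 3], ![1, 2, 2, 2, 3], ![1, 2, 2, 3, 4]]],
    ![![![0, 1, 2, 3, 3], ![1, 1, 2, 3, 3], ![1, 1, 2, 3, 4]],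
      ![![0, 1, 2, 3, 3], ![1, 2, 2, 3, 3], ![1, 2, 2, 3, 4]],
      ![![1, 1, 2, 3, 3], ![2, 2, 2, 3, 4], ![2, 2, 2, 3, 4]]],
    ![![![0, 1, 2, 3, 3], ![1, 1, 2, 3, 3], ![1, 1, 2, 3, 4]],
      ![![1, 2, 3, 3, 3], ![1, 2, 3, 3, 3], ![1, 2, 3, 3, 4]],
      ![![1, 2, 3, 3, 4], ![2, 2, 3, 3, 4], ![2, 2, 3, 4, 5]]]]

/-- Adding one column, with outer vertex selected iff `x` and inner vertex selected iff `y`. -/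
lemma statusBound_step : ∀ (s p q : Fin 3) (r : ZMod 5) (x y : Bool),
    (s = 0 → x = true) → (p = 0 → y = true) →
    5 * statusBound (status x (y || s = 2)) q (status y (x || p = 2)) (r + 1) + 3 * r.val + 3 ≤
      5 * statusBound s p q r + 5 * (x.toNat + y.toNat) + 3 * (r + 1).val := by
  unfold ZMod
  decide +kernel

lemma two_le_statusBound_one : ∀ s p q : Fin 3, p ≠ 0 → q ≠ 0 → 2 ≤ statusBound s p q 1 := by
  decide +kernel

lemma status_eq_two {x y : Bool} : status x y = 2 ↔ x = true := by
  revert x y; decide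

lemma status_eq_zero {x y : Bool} : status x y = 0 ↔ x = false ∧ y = false := by
  revert x y; decide

/-- The status of the outer vertex `j` relative to the columns up to `j`. -/
def outerStatus (a b : ℕ → Bool) (j : ℕ) : Fin 3 := status (a j) (b j || a (j - 1))

/-- The status of the inner vertex `j` relative to the columns up to `j`. -/
def innerStatus (a b : ℕ → Bool) (j : ℕ) : Fin 3 := status (b j) (a j || b (j - 2))

lemma statusBound_le_count {a b : ℕ → Bool} {N : ℕ} (hb1 : b 1 = true) (hb2 : b 2 = true)
    (ha2 : a 2 = false)
    (hout : ∀ j, 2 ≤ j → j < N → a j ∨ a (j - 1) ∨ a (j + 1) ∨ b j)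
    (hin : ∀ j, 1 ≤ j → b j ∨ b (j - 2) ∨ b (j + 2) ∨ a j) (j : ℕ) (hj : j + 2 ≤ N) :
    5 * statusBound (outerStatus a b (j + 2)) (innerStatus a b (j + 1)) (innerStatus a b (j + 2))
        ((j + 2 : ℕ) : ZMod 5) + 3 * (j + 2) ≤
      5 * ∑ i ∈ Finset.range (j + 3), ((a i).toNat + (b i).toNat) +
        3 * ((j + 2 : ℕ) : ZMod 5).val := by
  induction j with
  | zero =>
    have hs : outerStatus a b 2 = 1 := by simp [outerStatus, status, ha2, hb2]
    have hp : innerStatus a b 1 = 2 := by simp [innerStatus, status, hb1]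
    have hq : innerStatus a b 2 = 2 := by simp [innerStatus, status, hb2]
    have ht : statusBound 1 2 2 ((2 : ℕ) : ZMod 5) = 2 := by decide
    have hv : ((2 : ℕ) : ZMod 5).val = 2 := by decide
    simp only [zero_add, hs, hp, hq, ht, hv, Finset.sum_range_succ, hb1, hb2, Bool.toNat_true]
    omega
  | succ j ih =>
    have ih := ih (by omega)
    have hstep := statusBound_step (outerStatus a b (j + 2)) (innerStatus a b (j + 1))
      (innerStatus a b (j + 2)) ((j + 2 : ℕ) : ZMod 5) (a (j + 3)) (b (j + 3))
      (fun h => by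
        have := hout (j + 2) (by omega) (by omega)
        simp_all [outerStatus, status_eq_zero])
      (fun h => by
        have := hin (j + 1) (by omega)
        simp_all [innerStatus, status_eq_zero])
    have hs : status (a (j + 3)) (b (j + 3) || outerStatus a b (j + 2) = 2) =
        outerStatus a b (j + 3) := by simp [outerStatus, status_eq_two]
    have hq : status (b (j + 3)) (a (j + 3) || innerStatus a b (j + 1) = 2) =
        innerStatus a b (j + 3) := by simp [innerStatus, status_eq_two]
    have hr : ((j + 2 : ℕ) : ZMod 5) + 1 = ((j + 3 : ℕ) : ZMod 5) := by push_cast; ring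
    rw [hs, hq, hr] at hstep
    rw [Finset.sum_range_succ]
    simp only [show j + 1 + 2 = j + 3 by ring, show j + 1 + 1 = j + 2 by ring]
    omega

lemma outer_dominated {n : ℕ} {f : ZMod n} {S : Set (PVert n)} (h : IsDomSetF n f S) {i : ZMod n}
    (hi : i ≠ f) : uV i ∈ S ∨ uV (i - 1) ∈ S ∨ uV (i + 1) ∈ S ∨ vV i ∈ S := by
  rcases h.2 (uV i) (by simpa [uV] using hi) with h | ⟨w, hw, hadj⟩
  · exact .inl h
  · simp only [P2, SimpleGraph.fromRel_adj, uV, vV] at hadj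
    rcases hadj with ⟨-, (⟨k, rfl, h⟩ | ⟨k, rfl, h⟩ | ⟨k, rfl, h⟩) |
      (⟨k, h, rfl⟩ | ⟨k, h, rfl⟩ | ⟨k, h, rfl⟩)⟩ <;> simp at h <;> subst h <;>
      simp_all [uV, vV]

lemma inner_dominated {n : ℕ} {f : ZMod n} {S : Set (PVert n)} (h : IsDomSetF n f S)
    (i : ZMod n) : vV i ∈ S ∨ vV (i - 2) ∈ S ∨ vV (i + 2) ∈ S ∨ uV i ∈ S := by
  rcases h.2 (vV i) (by simp [uV, vV]) with h | ⟨w, hw, hadj⟩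
  · exact .inl h
  · simp only [P2, SimpleGraph.fromRel_adj, uV, vV] at hadj
    rcases hadj with ⟨-, (⟨k, rfl, h⟩ | ⟨k, rfl, h⟩ | ⟨k, rfl, h⟩) |
      (⟨k, h, rfl⟩ | ⟨k, h, rfl⟩ | ⟨k, h, rfl⟩)⟩ <;> simp at h <;> subst h <;>
      simp_all [uV, vV]

open Classical in
lemma ncard_eq_sum_columns {n : ℕ} [NeZero n] (f : ZMod n) (S : Set (PVert n)) :
    S.ncard = ∑ j ∈ Finset.range n,
      ((decide (uV (f + (j : ZMod n)) ∈ S)).toNat + (decide (vV (f + (j : ZMod n)) ∈ S)).toNat) := by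
  have h : S.ncard = ∑ i : ZMod n, ((decide (uV i ∈ S)).toNat + (decide (vV i ∈ S)).toNat) := by
    rw [Set.ncard_eq_toFinset_card', ← Set.filter_mem_univ_eq_toFinset, Finset.card_filter,
      Fintype.sum_sum_type, ← Finset.sum_add_distrib]
    refine Finset.sum_congr rfl fun i _ => ?_
    by_cases hu : uV i ∈ S <;> by_cases hv : vV i ∈ S <;> simp_all [uV, vV]
  rw [h, ← Equiv.sum_comp (Equiv.addLeft f)]
  refine Finset.sum_nbij' (fun i => i.val) (fun j => (j : ZMod n)) ?_ ?_ ?_ ?_ ?_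
  · simp [ZMod.val_lt]
  · simp
  · simp
  · intro j hj
    exact ZMod.val_cast_of_lt (Finset.mem_range.mp hj)
  · intro i _
    rw [Equiv.coe_addLeft, ZMod.natCast_zmod_val]

/-- for `n ≡ 4 (mod 5)`, every Type II set has cardinality at
least `⌈3n/5⌉`. -/
theorem typeII_lower_bound_mod4 (n : ℕ) (hn : 11 ≤ n) (hmod : n % 5 = 4)
    (f : ZMod n) (S : Set (PVert n)) (hS : TypeII n f S) :
    ceil35 n ≤ S.ncard := by
  classical
  obtain ⟨⟨⟨hdom, -⟩, -⟩, -, -, hblk⟩ := hS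
  have : NeZero n := ⟨by omega⟩
  obtain ⟨m, rfl⟩ : ∃ m, n = m + 4 := ⟨n - 4, by omega⟩
  have hu2 : uV (f - 2) ∈ S :=
    (hblk.ge (by simp) : uV (f - 2) ∈ Blk (m + 4) f ∩ S).2
  have hv1 : vV (f + 1) ∈ S :=
    (hblk.ge (by simp) : vV (f + 1) ∈ Blk (m + 4) f ∩ S).2
  have hv2 : vV (f + 2) ∈ S :=
    (hblk.ge (by simp) : vV (f + 2) ∈ Blk (m + 4) f ∩ S).2
  have hcast : ∀ i j : ℕ, i < m + 4 → j < m + 4 → i ≠ j → (i : ZMod (m + 4)) ≠ j := by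
    intro i j hi hj hij h
    exact hij (by simpa [ZMod.val_cast_of_lt hi, ZMod.val_cast_of_lt hj] using congrArg ZMod.val h)
  have hzero : (m : ZMod (m + 4)) + 4 = 0 := by
    exact_mod_cast ZMod.natCast_self (m + 4)
  have hpos2 : f + ((m + 2 : ℕ) : ZMod (m + 4)) = f - 2 := by
    push_cast; linear_combination hzero
  have hpos1 : f + ((m + 3 : ℕ) : ZMod (m + 4)) = f - 1 := by
    push_cast; linear_combination hzero
  have hu2' : uV (f + 2) ∉ S := by
    intro h
    have hmem : uV (f + 2) ∈ Blk (m + 4) f ∩ S := ⟨by simp [Blk], h⟩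
    rw [hblk] at hmem
    have := hcast 2 (m + 2) (by omega) (by omega) (by omega)
    have h2 : f + 2 = f - 2 := by simpa [uV, vV] using hmem
    rw [← hpos2] at h2
    exact this (by simpa using h2)
  have hv_neg : ∀ i : ℕ, m + 2 ≤ i → i < m + 4 → vV (f + (i : ZMod (m + 4))) ∉ S := by
    intro i hi hi' h
    have hblk_mem : vV (f + (i : ZMod (m + 4))) ∈ Blk (m + 4) f := by
      obtain rfl | rfl : i = m + 2 ∨ i = m + 3 := by omega
      · rw [hpos2]; simp [Blk]
      · rw [hpos1]; simp [Blk]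
    have hmem : vV (f + (i : ZMod (m + 4))) ∈ Blk (m + 4) f ∩ S := ⟨hblk_mem, h⟩
    rw [hblk] at hmem
    have h1 := hcast i 1 hi' (by omega) (by omega)
    have h2 := hcast i 2 hi' (by omega) (by omega)
    simp_all [uV, vV]
  set a : ℕ → Bool := fun j => decide (uV (f + (j : ZMod (m + 4))) ∈ S) with ha
  set b : ℕ → Bool := fun j => decide (vV (f + (j : ZMod (m + 4))) ∈ S) with hb
  have hb1 : b 1 = true := by simpa [hb] using hv1
  have hb2 : b 2 = true := by simpa [hb] using hv2
  have hin : ∀ j, 1 ≤ j → b j ∨ b (j - 2) ∨ b (j + 2) ∨ a j := by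
    intro j hj
    obtain rfl | ⟨k, rfl⟩ : j = 1 ∨ ∃ k, j = k + 2 :=
      or_iff_not_imp_left.mpr fun h => ⟨j - 2, by omega⟩
    · exact .inl hb1
    · have h := inner_dominated hdom (f + ((k + 2 : ℕ) : ZMod (m + 4)))
      have h2 : f + ((k + 2 : ℕ) : ZMod (m + 4)) - 2 = f + (k : ZMod (m + 4)) := by
        push_cast; ring
      rw [h2] at h
      simpa [ha, hb, add_assoc, show (2 : ZMod (m + 4)) + 2 = 4 by norm_num] using h
  have hout : ∀ j, 2 ≤ j → j < m + 1 → a j ∨ a (j - 1) ∨ a (j + 1) ∨ b j := by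
    intro j hj hjm
    obtain ⟨k, rfl⟩ : ∃ k, j = k + 1 := ⟨j - 1, by omega⟩
    have hne : f + ((k + 1 : ℕ) : ZMod (m + 4)) ≠ f := by
      simpa using hcast (k + 1) 0 (by omega) (by omega) (by omega)
    have h := outer_dominated hdom hne
    have h2 : f + ((k + 1 : ℕ) : ZMod (m + 4)) - 1 = f + (k : ZMod (m + 4)) := by
      push_cast; ring
    rw [h2] at h
    simpa [ha, hb, add_assoc, one_add_one_eq_two] using h
  obtain ⟨j, rfl⟩ : ∃ j, m = j + 1 := ⟨m - 1, by omega⟩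
  have hcount := statusBound_le_count hb1 hb2 (by simpa [ha] using hu2') hout hin j (by omega)
  have hbneg2 : b (j + 3) = false := by simpa [hb] using hv_neg (j + 3) (by omega) (by omega)
  have hbneg1 : b (j + 4) = false := by simpa [hb] using hv_neg (j + 4) (by omega) (by omega)
  have hp : innerStatus a b (j + 1) ≠ 0 := by
    have := hin (j + 1) (by omega)
    intro h
    simp only [innerStatus, status_eq_zero, Bool.or_eq_false_iff] at h
    rw [h.1, h.2.1, h.2.2, hbneg2] at this
    simp at this
  have hq : innerStatus a b (j + 2) ≠ 0 := by
    have := hin (j + 2) (by omega)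
    intro h
    simp only [innerStatus, status_eq_zero, Bool.or_eq_false_iff] at h
    rw [h.1, h.2.1, h.2.2, hbneg1] at this
    simp at this
  have hr : ((j + 2 : ℕ) : ZMod 5) = 1 := by
    have : (j + 2) % 5 = 1 := by omega
    rw [← ZMod.natCast_mod, this, Nat.cast_one]
  have hbound := two_le_statusBound_one (outerStatus a b (j + 2)) _ _ hp hq
  have hval : (1 : ZMod 5).val = 1 := by decide
  rw [hr, hval] at hcount
  have hlast : a (j + 3) = true := by
    simpa only [ha, decide_eq_true_eq, ← hpos2] using hu2
  have hcard : S.ncard = ∑ i ∈ Finset.range (j + 5), ((a i).toNat + (b i).toNat) :=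
    ncard_eq_sum_columns f S
  rw [Finset.sum_range_succ, Finset.sum_range_succ, hlast, Bool.toNat_true] at hcard
  have hfinal : 3 * (j + 1 + 4) ≤ 5 * S.ncard := by omega
  rw [ceil35, Nat.ceil_le, div_le_iff₀ (by norm_num)]
  have : (3 * ((j + 1 + 4 : ℕ) : ℚ)) ≤ 5 * S.ncard := by exact_mod_cast hfinal
  linarith

end PetersenDom
end

section
/- Let n ≥ 3 and let f ∈ ℤ/nℤ. Then γ(P_f(n,2)) = γ(P(n,2)) − 1 if n ≡ 1 (mod 5) or n ≡ 2 (mod 5), and γ(P_f(n,2)) = γ(P(n,2)) otherwise. -/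
namespace PetersenDom

/-! ### Domination in terms of the two membership sequences -/

lemma exists_adj_uV_iff {n : ℕ} (hn : 3 ≤ n) (S : Set (PVert n)) (x : ZMod n) :
    (∃ w ∈ S, (P2 n).Adj w (uV x)) ↔ uV (x - 1) ∈ S ∨ uV (x + 1) ∈ S ∨ vV x ∈ S := by
  have : Fact (1 < n) := ⟨by omega⟩
  constructor
  · rintro ⟨w, hw, -, (⟨i, h, h'⟩ | ⟨i, h, h'⟩ | ⟨i, h, h'⟩) | ⟨i, h, h'⟩ | ⟨i, h, h'⟩ | ⟨i, h, h'⟩⟩ <;>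
      simp only [uV, vV, Sum.inl.injEq, reduceCtorEq] at h h' ⊢ <;> subst h <;> subst h' <;>
      simp_all
  · rintro (h | h | h)
    · refine ⟨_, h, by simp [uV], Or.inl (Or.inl ⟨x - 1, rfl, by simp⟩)⟩
    · exact ⟨_, h, by simp [uV], Or.inr (Or.inl ⟨x, rfl, rfl⟩)⟩
    · exact ⟨_, h, by simp [uV, vV], Or.inr (Or.inr (Or.inl ⟨x, rfl, rfl⟩))⟩

lemma exists_adj_vV_iff {n : ℕ} (hn : 3 ≤ n) (S : Set (PVert n)) (x : ZMod n) :
    (∃ w ∈ S, (P2 n).Adj w (vV x)) ↔ vV (x - 2) ∈ S ∨ vV (x + 2) ∈ S ∨ uV x ∈ S := by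
  have h2 : (2 : ZMod n) ≠ 0 := by
    intro h
    have := (ZMod.natCast_eq_zero_iff 2 n).1 (by exact_mod_cast h)
    exact absurd (Nat.le_of_dvd (by norm_num) this) (by omega)
  constructor
  · rintro ⟨w, hw, -, (⟨i, h, h'⟩ | ⟨i, h, h'⟩ | ⟨i, h, h'⟩) | ⟨i, h, h'⟩ | ⟨i, h, h'⟩ | ⟨i, h, h'⟩⟩ <;>
      simp only [uV, vV, Sum.inr.injEq, reduceCtorEq] at h h' ⊢ <;> subst h <;> subst h' <;>
      simp_all
  · rintro (h | h | h)
    · refine ⟨_, h, by simp [vV, h2], Or.inl (Or.inr (Or.inr ⟨x - 2, rfl, by simp⟩))⟩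
    · exact ⟨_, h, by simp [vV, h2], Or.inr (Or.inr (Or.inr ⟨x, rfl, rfl⟩))⟩
    · exact ⟨_, h, by simp [uV, vV], Or.inl (Or.inr (Or.inl ⟨x, rfl, rfl⟩))⟩

lemma sum_range_add_natCast {n : ℕ} [NeZero n] (c : ZMod n) (g : ZMod n → ℕ) :
    ∑ k ∈ Finset.range n, g (c + (k : ZMod n)) = ∑ x, g x := by
  refine Finset.sum_bij (fun k _ => c + (k : ZMod n)) (by simp) ?_ ?_ (by simp)
  · intro i hi j hj h
    have h' := (ZMod.natCast_eq_natCast_iff' i j n).1 (add_left_cancel h)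
    rwa [Nat.mod_eq_of_lt (Finset.mem_range.1 hi), Nat.mod_eq_of_lt (Finset.mem_range.1 hj)] at h'
  · intro x _
    exact ⟨(x - c).val, Finset.mem_range.2 (ZMod.val_lt _), by simp⟩

open scoped Classical in
lemma ncard_eq_sum {n : ℕ} [NeZero n] (S : Set (PVert n)) (c : ZMod n) :
    S.ncard = ∑ k ∈ Finset.range n,
      ((decide (uV (c + (k : ZMod n)) ∈ S)).toNat + (decide (vV (c + (k : ZMod n)) ∈ S)).toNat) := by
  rw [sum_range_add_natCast c
    (fun x => (decide (uV x ∈ S)).toNat + (decide (vV x ∈ S)).toNat), Finset.sum_add_distrib,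
    Set.ncard_eq_toFinset_card', show S.toFinset = Finset.univ.filter (· ∈ S) by ext; simp,
    Finset.card_filter, Fintype.sum_sum_type]
  simp only [Bool.toNat, cond_eq_ite, uV, vV]
  congr! <;> exact decide_eq_true_iff.symm

/-! ### Scanning the columns -/

/-- The information kept while scanning the columns `{u_x, v_x}` from left to right: the marks of
`u_x`, `v_x` and `v_{x-1}`, where a vertex is marked `2` if it is selected, `1` if it is dominated
by a selected vertex of a column scanned so far, and `0` otherwise. -/
abbrev ScanState := Fin 3 × Fin 3 × Fin 3

/-- The next column may be selected according to `a` and `b` without leaving behind a vertex that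
is not dominated. -/
abbrev Admissible (s : ScanState) (a b : Bool) : Prop :=
  (s.1 = 0 → a = true) ∧ (s.2.2 = 0 → b = true)

/-- The state after a next column selected according to `a` and `b`. -/
def push (s : ScanState) (a b : Bool) : ScanState :=
  (if a then 2 else if s.1 = 2 ∨ b then 1 else 0,
    if b then 2 else if s.2.2 = 2 ∨ a then 1 else 0, s.2.1)

/-- The position of a state in the lexicographic order. -/
def ScanState.code (s : ScanState) : ℕ := 9 * s.1 + 3 * s.2.1 + s.2.2

/-- A time-dependent potential decreasing by at least `3 - 5w` along each admissible step that
selects `w` vertices bounds the number of selected vertices. -/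
lemma potential_add_le (φ : ℕ → ScanState → ℕ)
    (hφ : ∀ k s a b, Admissible s a b →
      φ (k + 1) (push s a b) + 3 ≤ φ k s + 5 * (a.toNat + b.toNat))
    (σ : ℕ → ScanState) (a b : ℕ → Bool) (n : ℕ)
    (hadm : ∀ k < n, Admissible (σ k) (a k) (b k))
    (hσ : ∀ k < n, σ (k + 1) = push (σ k) (a k) (b k)) :
    φ n (σ n) + 3 * n ≤ φ 0 (σ 0) + 5 * ∑ k ∈ Finset.range n, ((a k).toNat + (b k).toNat) := by
  induction n with
  | zero => simp
  | succ n ih =>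
    have h₁ := ih (fun k hk => hadm k (by omega)) (fun k hk => hσ k (by omega))
    have h₂ := hφ n _ _ _ (hadm n (by omega))
    rw [Finset.sum_range_succ, hσ n (by omega)]
    omega

/-- Mark of `u_x`, if the outer and inner selections are `a` and `b`. -/
def outerMark {n : ℕ} (a b : ZMod n → Bool) (x : ZMod n) : Fin 3 :=
  if a x then 2 else if a (x - 1) ∨ b x then 1 else 0

/-- Mark of `v_x`, if the outer and inner selections are `a` and `b`. -/
def innerMark {n : ℕ} (a b : ZMod n → Bool) (x : ZMod n) : Fin 3 :=
  if b x then 2 else if b (x - 2) ∨ a x then 1 else 0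

lemma outerMark_eq_two {n : ℕ} {a b : ZMod n → Bool} {x : ZMod n} :
    outerMark a b x = 2 ↔ a x = true := by
  unfold outerMark; split_ifs <;> simp_all

lemma innerMark_eq_two {n : ℕ} {a b : ZMod n → Bool} {x : ZMod n} :
    innerMark a b x = 2 ↔ b x = true := by
  unfold innerMark; split_ifs <;> simp_all

lemma outerMark_eq_zero {n : ℕ} {a b : ZMod n → Bool} {x : ZMod n} :
    outerMark a b x = 0 ↔ a x = false ∧ a (x - 1) = false ∧ b x = false := by
  unfold outerMark; cases a x <;> cases a (x - 1) <;> cases b x <;> simp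

lemma innerMark_eq_zero {n : ℕ} {a b : ZMod n → Bool} {x : ZMod n} :
    innerMark a b x = 0 ↔ b x = false ∧ b (x - 2) = false ∧ a x = false := by
  unfold innerMark; cases b x <;> cases b (x - 2) <;> cases a x <;> simp

/-- State of the scan at column `x`. -/
def scanState {n : ℕ} (a b : ZMod n → Bool) (x : ZMod n) : ScanState :=
  (outerMark a b x, innerMark a b x, innerMark a b (x - 1))

lemma push_innerMark {n : ℕ} (a b : ZMod n → Bool) (x : ZMod n) (m : Fin 3)
    (hm : m = 2 ↔ a x = true) :
    push (m, innerMark a b x, innerMark a b (x - 1)) (a (x + 1)) (b (x + 1)) =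
      scanState a b (x + 1) := by
  have h : x + 1 - 2 = x - 1 := by ring
  simp only [push, scanState, hm, innerMark_eq_two, add_sub_cancel_right]
  simp only [outerMark, innerMark, h, add_sub_cancel_right]

/-! ### Lower bounds -/

/-- Potential for dominating sets of `P(n,2)`. -/
def potential (s : ScanState) : ℕ :=
  [0, 3, 4, 4, 4, 4, 10, 10, 10, 7, 3, 7, 7, 6, 7, 5, 7, 7, 10, 10, 10, 5, 6, 9, 7, 10,
    10].getD s.code 0

lemma potential_push (s : ScanState) (a b : Bool) (h : Admissible s a b) :
    potential (push s a b) + 3 ≤ potential s + 5 * (a.toNat + b.toNat) := by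
  revert s a b
  decide +kernel

/-- Potentials for dominating sets of `P_f(n,2)` that do not dominate `u_f`; they depend on the
mark of `v_f` and on the distance to `f` modulo `5`. -/
def deletedPotential : Fin 2 → Fin 5 → ScanState → ℕ
  | 0, 0, s => [2, 3, 6, 6, 6, 6, 12, 12, 12, 3, 3, 7, 9, 8, 9, 7, 8, 9, 12, 12, 12, 7, 8, 11, 9,
      12, 12].getD s.code 0
  | 0, 1, s => [0, 5, 5, 4, 6, 6, 12, 12, 12, 9, 5, 9, 9, 8, 9, 5, 9, 9, 12, 12, 12, 5, 8, 10, 9,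
      12, 12].getD s.code 0
  | 0, 2, s => [2, 5, 6, 6, 6, 6, 12, 12, 12, 9, 5, 9, 9, 7, 9, 7, 7, 7, 12, 12, 12, 7, 8, 11, 7,
      11, 12].getD s.code 0
  | 0, 3, s => [2, 4, 4, 6, 6, 4, 12, 12, 12, 9, 5, 8, 9, 8, 9, 7, 9, 9, 12, 12, 12, 7, 8, 9, 9,
      12, 12].getD s.code 0
  | 0, 4, s => [2, 5, 6, 5, 6, 6, 12, 12, 12, 9, 5, 9, 9, 6, 9, 7, 9, 9, 12, 12, 12, 6, 6, 11, 9,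
      11, 12].getD s.code 0
  | 1, 0, s => [2, 5, 6, 6, 6, 6, 12, 12, 12, 9, 5, 9, 6, 7, 7, 7, 7, 7, 12, 12, 12, 6, 8, 11, 7,
      12, 12].getD s.code 0
  | 1, 1, s => [2, 4, 4, 6, 4, 4, 12, 12, 12, 9, 5, 9, 9, 8, 9, 7, 8, 9, 12, 12, 12, 7, 8, 9, 9,
      12, 12].getD s.code 0
  | 1, 2, s => [2, 5, 5, 6, 6, 6, 12, 12, 12, 9, 5, 9, 9, 6, 9, 7, 9, 9, 12, 12, 12, 6, 6, 10, 9,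
      11, 12].getD s.code 0
  | 1, 3, s => [2, 3, 6, 6, 6, 6, 12, 12, 12, 9, 3, 8, 9, 7, 9, 7, 8, 9, 12, 12, 12, 7, 8, 11, 9,
      12, 12].getD s.code 0
  | 1, 4, s => [0, 4, 5, 5, 6, 6, 12, 12, 12, 9, 5, 9, 9, 8, 9, 5, 9, 9, 12, 12, 12, 5, 8, 10, 9,
      12, 12].getD s.code 0

lemma deletedPotential_push (m : Fin 2) (r : Fin 5) (s : ScanState) (a b : Bool)
    (h : Admissible s a b) :
    deletedPotential m (r + 1) (push s a b) + 3 ≤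
      deletedPotential m r s + 5 * (a.toNat + b.toNat) := by
  revert m r s a b
  decide +kernel

lemma deletedPotential_start_le (m : Fin 2) (r : Fin 5) (p : Fin 3) :
    deletedPotential m 0 (1, m.castSucc, p) ≤
      deletedPotential m r (0, m.castSucc, p) + ![4, 7, 5, 3, 1] r := by
  revert m r p
  decide +kernel

lemma le_ncard_of_isDomSet {n : ℕ} (hn : 3 ≤ n) {S : Set (PVert n)} (hS : IsDomSet (P2 n) S) :
    3 * n ≤ 5 * S.ncard := by
  classical
  have : NeZero n := ⟨by omega⟩
  have key := potential_add_le (fun _ => potential) (fun _ => potential_push)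
    (fun k => scanState (fun x => decide (uV x ∈ S)) (fun x => decide (vV x ∈ S)) (k : ZMod n))
    (fun k => decide (uV ((k : ZMod n) + 1) ∈ S)) (fun k => decide (vV ((k : ZMod n) + 1) ∈ S))
    n ?_ ?_
  · have hcard := ncard_eq_sum S (1 : ZMod n)
    simp only [add_comm (1 : ZMod n)] at hcard
    simp only [ZMod.natCast_self, Nat.cast_zero, ← hcard] at key
    omega
  · intro k _
    have hu := hS (uV k)
    have hv := hS (vV (k - 1))
    rw [exists_adj_uV_iff hn] at hu
    rw [exists_adj_vV_iff hn, show (k : ZMod n) - 1 + 2 = k + 1 by ring] at hv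
    simp only [Admissible, scanState, outerMark_eq_zero, innerMark_eq_zero,
      decide_eq_false_iff_not, decide_eq_true_iff]
    tauto
  · intro k _
    rw [Nat.cast_succ]
    exact (push_innerMark _ _ _ _ outerMark_eq_two).symm

lemma le_ncard_of_isDomSetF {n : ℕ} (hn : 3 ≤ n) {f : ZMod n} {S : Set (PVert n)}
    (hS : IsDomSetF n f S) : 3 * (n / 5) + (n % 5 - 1) ≤ S.ncard := by
  classical
  have : NeZero n := ⟨by omega⟩
  by_cases hf : ∃ w ∈ S, (P2 n).Adj w (uV f)
  · have := le_ncard_of_isDomSet hn (S := S) fun v =>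
      if hv : v = uV f then Or.inr (hv ▸ hf) else hS.2 v hv
    omega
  rw [exists_adj_uV_iff hn] at hf
  push Not at hf
  set a : ZMod n → Bool := fun x => decide (uV x ∈ S) with ha
  set b : ZMod n → Bool := fun x => decide (vV x ∈ S) with hb
  have h_outer : outerMark a b f = 0 := by
    rw [outerMark_eq_zero]
    simpa [ha, hb] using ⟨hS.1, hf.1, hf.2.2⟩
  obtain ⟨m, hm⟩ : ∃ m : Fin 2, innerMark a b f = m.castSucc := by
    refine ⟨(innerMark a b f).castPred ?_, (Fin.castSucc_castPred _ _).symm⟩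
    change ¬ innerMark a b f = 2
    rw [innerMark_eq_two]
    simpa [hb] using hf.2.2
  have key := potential_add_le (fun k => deletedPotential m (Fin.ofNat 5 k))
    (fun k s c d h => by
      have := deletedPotential_push m (Fin.ofNat 5 k) s c d h
      rwa [show Fin.ofNat 5 k + 1 = Fin.ofNat 5 (k + 1) from
        Fin.ext (by change (k % 5 + 1) % 5 = (k + 1) % 5; omega)] at this)
    (fun k => if k = 0 then (1, innerMark a b f, innerMark a b (f - 1)) else scanState a b (f + k))
    (fun k => a (f + k + 1)) (fun k => b (f + k + 1)) n ?_ ?_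
  · have hcard := ncard_eq_sum S (f + 1)
    simp only [add_right_comm f 1] at hcard
    have h_start := deletedPotential_start_le m (Fin.ofNat 5 n) (innerMark a b (f - 1))
    simp only [ha, hb] at key
    rw [← hcard, if_neg (by omega : n ≠ 0), if_pos trivial, ZMod.natCast_self, add_zero, scanState,
      ← ha, ← hb, h_outer, hm] at key
    have h_need : 5 * (3 * (n / 5) + (n % 5 - 1)) ≤ 3 * n - ![4, 7, 5, 3, 1] (Fin.ofNat 5 n) + 4 := by
      obtain ⟨r, q, hr, rfl⟩ : ∃ r q, r < 5 ∧ n = 5 * q + r :=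
        ⟨n % 5, n / 5, Nat.mod_lt _ (by norm_num), (Nat.div_add_mod n 5).symm⟩
      have h5 : Fin.ofNat 5 (5 * q + r) = Fin.ofNat 5 r := by ext; simp
      rw [h5]
      interval_cases r <;> simp [Fin.ofNat] <;> omega
    change _ ≤ deletedPotential m 0 _ + _ at key
    omega
  · intro k hk
    have hv := hS.2 (vV (f + k - 1)) (by simp [uV, vV])
    rw [exists_adj_vV_iff hn, show f + k - 1 + 2 = f + k + 1 by ring] at hv
    rcases Nat.eq_zero_or_pos k with rfl | hk0
    · simp only [Nat.cast_zero, add_zero, if_true] at hv ⊢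
      simp only [Admissible, innerMark_eq_zero, ha, hb, decide_eq_false_iff_not,
        decide_eq_true_iff]
      exact ⟨fun h => absurd h (by decide), by tauto⟩
    · have hne : uV (f + (k : ZMod n)) ≠ uV f := by
        simp only [uV, ne_eq, Sum.inl.injEq, add_eq_left]
        intro h
        exact absurd (Nat.le_of_dvd hk0 ((ZMod.natCast_eq_zero_iff k n).1 h)) (by omega)
      have hu := hS.2 _ hne
      rw [exists_adj_uV_iff hn] at hu
      simp only [if_neg hk0.ne', Admissible, scanState, outerMark_eq_zero, innerMark_eq_zero, ha,
        hb, decide_eq_false_iff_not, decide_eq_true_iff]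
      tauto
  · intro k _
    rw [if_neg (Nat.succ_ne_zero k), Nat.cast_succ, ← add_assoc]
    rcases Nat.eq_zero_or_pos k with rfl | hk0
    · simp only [Nat.cast_zero, add_zero, if_true]
      refine (push_innerMark a b f 1 ?_).symm
      simpa [ha] using hS.1
    · rw [if_neg hk0.ne']
      exact (push_innerMark _ _ _ _ outerMark_eq_two).symm

/-! ### Constructions -/

lemma exists_isDomSetF_of_pattern {n : ℕ} (hn : 3 ≤ n) (f : ZMod n) (U V : ℕ → Prop)
    [DecidablePred U] [DecidablePred V] (h0 : ¬ U 0)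
    (hU : ∀ i < n, 0 < i → U i ∨ U ((i + n - 1) % n) ∨ U ((i + 1) % n) ∨ V i)
    (hV : ∀ i < n, V i ∨ V ((i + n - 2) % n) ∨ V ((i + 2) % n) ∨ U i) :
    ∃ S : Set (PVert n), IsDomSetF n f S ∧
      S.ncard = ∑ k ∈ Finset.range n, ((if U k then 1 else 0) + (if V k then 1 else 0)) ∧
      (U (n - 1) ∨ U 1 ∨ V 0 → IsDomSet (P2 n) S) := by
  classical
  have : NeZero n := ⟨by omega⟩
  set S : Set (PVert n) :=
    {p | p.elim (fun x => U (x - f).val) (fun x => V (x - f).val)}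
  have memU (x : ZMod n) : uV x ∈ S ↔ U (x - f).val := Iff.rfl
  have memV (x : ZMod n) : vV x ∈ S ↔ V (x - f).val := Iff.rfl
  have val (x : ZMod n) (j : ℕ) (h : x - f = j) : (x - f).val = j % n := by
    rw [h, ZMod.val_natCast]
  have val_add (x : ZMod n) (j : ℕ) : (x + j - f).val = ((x - f).val + j) % n :=
    val _ _ (by push_cast; rw [ZMod.natCast_zmod_val]; ring)
  have val_sub (x : ZMod n) (j : ℕ) (hj : j ≤ n) :
      (x - j - f).val = ((x - f).val + n - j) % n :=
    val _ _ (by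
      rw [Nat.cast_sub (by omega)]
      push_cast
      rw [ZMod.natCast_zmod_val, ZMod.natCast_self]
      ring)
  have domU (x : ZMod n) (h : U (x - f).val ∨ U (((x - f).val + n - 1) % n) ∨
      U (((x - f).val + 1) % n) ∨ V (x - f).val) :
      uV x ∈ S ∨ ∃ w ∈ S, (P2 n).Adj w (uV x) := by
    rw [exists_adj_uV_iff hn, memU, memU, memU, memV]
    have h₁ := val_add x 1
    have h₂ := val_sub x 1 (by omega)
    rw [Nat.cast_one] at h₁ h₂
    rwa [h₁, h₂]
  have hF : IsDomSetF n f S := by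
    refine ⟨by simpa [memU] using h0, ?_⟩
    rintro (x | x) hx
    · refine domU x (hU _ (ZMod.val_lt _) (Nat.pos_of_ne_zero fun h => hx ?_))
      rw [ZMod.val_eq_zero, sub_eq_zero] at h
      rw [h]
      rfl
    · change vV x ∈ S ∨ ∃ w ∈ S, (P2 n).Adj w (vV x)
      rw [exists_adj_vV_iff hn, memV, memV, memV, memU]
      have h₁ := val_add x 2
      have h₂ := val_sub x 2 (by omega)
      rw [Nat.cast_ofNat] at h₁ h₂
      rw [h₁, h₂]
      exact hV _ (ZMod.val_lt _)
  refine ⟨S, hF, ?_, fun h v => ?_⟩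
  · rw [ncard_eq_sum S f]
    refine Finset.sum_congr rfl fun k hk => ?_
    simp [memU, memV, Bool.toNat, Bool.cond_decide, ZMod.val_natCast,
      Nat.mod_eq_of_lt (Finset.mem_range.1 hk)]
  · by_cases hv : v = uV f
    · subst hv
      apply domU
      rw [sub_self, ZMod.val_zero, Nat.mod_eq_of_lt (by omega : 0 + n - 1 < n),
        Nat.mod_eq_of_lt (by omega : 0 + 1 < n), zero_add, zero_add]
      exact Or.inr h
    · exact hF.2 v hv

lemma sum_range_five_mul (g : ℕ → ℕ) (c k : ℕ)
    (h : ∀ i < k, g (5 * i) + g (5 * i + 1) + g (5 * i + 2) + g (5 * i + 3) + g (5 * i + 4) = c) :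
    ∑ i ∈ Finset.range (5 * k), g i = c * k := by
  induction k with
  | zero => simp
  | succ k ih =>
    have hk := h k (by omega)
    rw [Nat.mul_succ]
    simp only [Finset.sum_range_succ, Finset.sum_range_succ, ih fun i hi => h i (by omega)]
    linarith

lemma mod_eq_ite_of_lt_two_mul (j n : ℕ) (h : j < 2 * n) :
    j % n = if j < n then j else j - n := by
  split_ifs with hj
  · exact Nat.mod_eq_of_lt hj
  · rw [Nat.mod_eq_sub_mod (by omega), Nat.mod_eq_of_lt (by omega)]

lemma exists_isDomSetF {n : ℕ} (hn : 3 ≤ n) (f : ZMod n) (hr : n % 5 = 1 ∨ n % 5 = 2) :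
    ∃ S : Set (PVert n), IsDomSetF n f S ∧ S.ncard = 3 * (n / 5) + (n % 5 - 1) := by
  obtain ⟨S, hS, hcard, -⟩ := exists_isDomSetF_of_pattern hn f
    (fun i => i % 5 = 4 ∨ (n % 5 = 2 ∧ i + 2 = n))
    (fun i => i % 5 = 2 ∨ (i % 5 = 1 ∧ i + 1 ≠ n)) (by omega)
    (fun i hi hi0 => by
      rw [mod_eq_ite_of_lt_two_mul (i + n - 1) n (by omega),
        mod_eq_ite_of_lt_two_mul (i + 1) n (by omega)]
      split_ifs <;> omega)
    (fun i hi => by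
      rw [mod_eq_ite_of_lt_two_mul (i + n - 2) n (by omega),
        mod_eq_ite_of_lt_two_mul (i + 2) n (by omega)]
      split_ifs <;> omega)
  · refine ⟨S, hS, hcard.trans ?_⟩
    have h₅ := sum_range_five_mul (fun i => (if i % 5 = 4 ∨ (n % 5 = 2 ∧ i + 2 = n) then 1 else 0) +
      (if i % 5 = 2 ∨ (i % 5 = 1 ∧ i + 1 ≠ n) then 1 else 0)) 3 (n / 5)
      (fun i hi => by
        simp
        split_ifs <;> omega)
    obtain ⟨q, h | h⟩ : ∃ q, n = 5 * q + 1 ∨ n = 5 * q + 2 := ⟨n / 5, by omega⟩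
    · rw [show n / 5 = q by omega] at h₅ ⊢
      conv_lhs => rw [show Finset.range n = Finset.range (5 * q + 1) by rw [h]]
      simp only [Finset.sum_range_succ, h₅]
      simp
      split_ifs <;> omega
    · rw [show n / 5 = q by omega] at h₅ ⊢
      conv_lhs => rw [show Finset.range n = Finset.range (5 * q + 2) by rw [h]]
      simp only [Finset.sum_range_succ, h₅]
      simp
      split_ifs <;> omega

lemma exists_isDomSetF_isDomSet {n : ℕ} (hn : 3 ≤ n) (f : ZMod n)
    (hr : ¬ (n % 5 = 1 ∨ n % 5 = 2)) :
    ∃ S : Set (PVert n), IsDomSetF n f S ∧ IsDomSet (P2 n) S ∧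
      S.ncard = 3 * (n / 5) + (n % 5 - 1) := by
  obtain ⟨S, hS, hcard, hdom⟩ := exists_isDomSetF_of_pattern hn f
    (fun i => i % 5 = 1 ∨ i % 5 = 4 ∨ (n % 5 = 4 ∧ i + 1 = n)) (fun i => i % 5 = 0)
    (by omega)
    (fun i hi hi0 => by
      rw [mod_eq_ite_of_lt_two_mul (i + n - 1) n (by omega),
        mod_eq_ite_of_lt_two_mul (i + 1) n (by omega)]
      split_ifs <;> omega)
    (fun i hi => by
      rw [mod_eq_ite_of_lt_two_mul (i + n - 2) n (by omega),
        mod_eq_ite_of_lt_two_mul (i + 2) n (by omega)]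
      split_ifs <;> omega)
  · refine ⟨S, hS, hdom (by omega), hcard.trans ?_⟩
    have h₅ := sum_range_five_mul
      (fun i => (if i % 5 = 1 ∨ i % 5 = 4 ∨ (n % 5 = 4 ∧ i + 1 = n) then 1 else 0) +
        (if i % 5 = 0 then 1 else 0)) 3 (n / 5) (fun i hi => by
        simp
        split_ifs <;> omega)
    obtain ⟨q, h | h | h⟩ : ∃ q, n = 5 * q ∨ n = 5 * q + 3 ∨ n = 5 * q + 4 := ⟨n / 5, by omega⟩
    · rw [show n / 5 = q by omega] at h₅ ⊢
      conv_lhs => rw [show Finset.range n = Finset.range (5 * q) by rw [h]]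
      rw [h₅]
      omega
    · rw [show n / 5 = q by omega] at h₅ ⊢
      conv_lhs => rw [show Finset.range n = Finset.range (5 * q + 3) by rw [h]]
      simp only [Finset.sum_range_succ, h₅]
      simp
      split_ifs <;> omega
    · rw [show n / 5 = q by omega] at h₅ ⊢
      conv_lhs => rw [show Finset.range n = Finset.range (5 * q + 4) by rw [h]]
      simp only [Finset.sum_range_succ, h₅]
      simp
      split_ifs <;> omega

/-! ### Domination numbers -/

lemma sInf_ncard_eq {V : Type*} {P : Set V → Prop} {k : ℕ} (h : ∃ S, P S ∧ S.ncard ≤ k)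
    (hle : ∀ S, P S → k ≤ S.ncard) : sInf {k | ∃ S, P S ∧ S.ncard = k} = k := by
  obtain ⟨S, hS, hk⟩ := h
  have hmem : S.ncard ∈ {k | ∃ S, P S ∧ S.ncard = k} := ⟨S, hS, rfl⟩
  refine le_antisymm ((Nat.sInf_le hmem).trans hk) (le_csInf ⟨_, hmem⟩ ?_)
  rintro k' ⟨T, hT, rfl⟩
  exact hle T hT

lemma domNumF_eq_formula {n : ℕ} (hn : 3 ≤ n) (f : ZMod n) :
    domNumF n f = 3 * (n / 5) + (n % 5 - 1) := by
  refine sInf_ncard_eq ?_ fun S hS => le_ncard_of_isDomSetF hn hS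
  by_cases hr : n % 5 = 1 ∨ n % 5 = 2
  · obtain ⟨S, hS, hcard⟩ := exists_isDomSetF hn f hr
    exact ⟨S, hS, hcard.le⟩
  · obtain ⟨S, hS, -, hcard⟩ := exists_isDomSetF_isDomSet hn f hr
    exact ⟨S, hS, hcard.le⟩

lemma domNum_P2_eq {n : ℕ} (hn : 3 ≤ n) : domNum (P2 n) = (3 * n + 4) / 5 := by
  refine sInf_ncard_eq ?_ fun S hS => ?_
  · by_cases hr : n % 5 = 1 ∨ n % 5 = 2
    · obtain ⟨S, hS, hcard⟩ := exists_isDomSetF hn 0 hr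
      refine ⟨insert (uV 0) S, fun v => ?_, (Set.ncard_insert_le _ _).trans (by omega)⟩
      by_cases hv : v = uV 0
      · exact Or.inl (Or.inl hv)
      · rcases hS.2 v hv with h | ⟨w, hw, h⟩
        · exact Or.inl (Or.inr h)
        · exact Or.inr ⟨w, Or.inr hw, h⟩
    · obtain ⟨S, -, hS, hcard⟩ := exists_isDomSetF_isDomSet hn 0 hr
      exact ⟨S, hS, by omega⟩
  · have := le_ncard_of_isDomSet hn hS
    omega

/-- `γ(P_f(n,2)) = γ(P(n,2)) - 1` when `n ≡ 1, 2 (mod 5)`, and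
`γ(P_f(n,2)) = γ(P(n,2))` otherwise. -/
theorem domNumF_eq (n : ℕ) (hn : 3 ≤ n) (f : ZMod n) :
    (n % 5 = 1 ∨ n % 5 = 2 → domNumF n f = domNum (P2 n) - 1) ∧
    (¬ (n % 5 = 1 ∨ n % 5 = 2) → domNumF n f = domNum (P2 n)) := by
  rw [domNumF_eq_formula hn, domNum_P2_eq hn]
  omega

end PetersenDom
end
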